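/- Let p be a prime and let S₁, S₂ be finite subsets of ℤ/pℤ with 0 ∉ S₁ ∪ S₂ and S₁ ∩ S₂ ≠ ∅; set S := S₁ ∪ S₂. If, for i = 1, 2, the lattice L(Sᵢ) is generated in degree ≤ dᵢ, then L(S) is generated in degree ≤ max(d₁, d₂). (Paper's Proposition on subsets: β_field(ℤ/pℤ, S) ≤ max(β_field(ℤ/pℤ, S₁), β_field(ℤ/pℤ, S₂)).) -/

import Mathlib

/-- For a finite subset `S` of `ℤ/nℤ`, the lattice `L(S) ⊆ ℤ^S`: functions `ZMod n → ℤ`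
vanishing outside `S` (the copy of `ℤ^S` inside `ℤ^{ℤ/nℤ}`) whose `S`-weighted sum vanishes
in `ℤ/nℤ`. -/
def latFin {n : ℕ} (S : Finset (ZMod n)) : AddSubgroup (ZMod n → ℤ) where
  carrier := {a | (∀ χ ∉ S, a χ = 0) ∧ ∑ χ ∈ S, a χ • χ = 0}
  zero_mem' := by simp
  add_mem' := by
    intro a b ha hb
    refine ⟨fun χ hχ => ?_, ?_⟩
    · simp [ha.1 χ hχ, hb.1 χ hχ]
    · have h2 : ∑ χ ∈ S, (a + b) χ • χ = (∑ χ ∈ S, a χ • χ) + ∑ χ ∈ S, b χ • χ := by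
        simp [Pi.add_apply, add_smul, Finset.sum_add_distrib]
      rw [h2, ha.2, hb.2, add_zero]
  neg_mem' := by
    intro a ha
    refine ⟨fun χ hχ => ?_, ?_⟩
    · simp [ha.1 χ hχ]
    · have h2 : ∑ χ ∈ S, (-a) χ • χ = -∑ χ ∈ S, a χ • χ := by
        simp [Pi.neg_apply, neg_smul, Finset.sum_neg_distrib]
      rw [h2, ha.2, neg_zero]

/-- `L(S)` is generated in degree `≤ d`: it is generated, as an additive group, by its
nonnegative elements of degree `≤ d`. -/
def genLE {n : ℕ} (S : Finset (ZMod n)) (d : ℕ) : Prop :=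
  AddSubgroup.closure
      {a | a ∈ latFin S ∧ (∀ χ, 0 ≤ a χ) ∧ ∑ χ ∈ S, a χ ≤ (d : ℤ)} = latFin S

theorem mem_latFin_iff {n : ℕ} {S : Finset (ZMod n)} {a : ZMod n → ℤ} :
    a ∈ latFin S ↔ (∀ χ ∉ S, a χ = 0) ∧ ∑ χ ∈ S, a χ • χ = 0 :=
  Iff.rfl

theorem mem_latFin_iff_of_subset {n : ℕ} {S T : Finset (ZMod n)} (hST : S ⊆ T)
    {a : ZMod n → ℤ} (ha : ∀ χ ∉ S, a χ = 0) : a ∈ latFin T ↔ a ∈ latFin S := by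
  have hsum : ∑ χ ∈ S, a χ • χ = ∑ χ ∈ T, a χ • χ :=
    Finset.sum_subset hST fun χ _ hχ => by rw [ha χ hχ, zero_smul]
  rw [mem_latFin_iff, mem_latFin_iff, hsum]
  exact ⟨fun h => ⟨ha, h.2⟩, fun h => ⟨fun χ hχ => ha χ fun h' => hχ (hST h'), h.2⟩⟩

theorem latFin_mono {n : ℕ} {S T : Finset (ZMod n)} (hST : S ⊆ T) : latFin S ≤ latFin T :=
  fun _ ha => (mem_latFin_iff_of_subset hST ha.1).2 ha

theorem genLE.latFin_le_closure {n : ℕ} {S T : Finset (ZMod n)} {d e : ℕ} (h : genLE S d)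
    (hST : S ⊆ T) (hde : d ≤ e) :
    latFin S ≤ AddSubgroup.closure
      {a | a ∈ latFin T ∧ (∀ χ, 0 ≤ a χ) ∧ ∑ χ ∈ T, a χ ≤ (e : ℤ)} := by
  refine h.symm.le.trans (AddSubgroup.closure_mono ?_)
  rintro a ⟨ha, hpos, hdeg⟩
  refine ⟨latFin_mono hST ha, hpos, ?_⟩
  rw [← Finset.sum_subset hST fun χ _ hχ => ha.1 χ hχ]
  exact hdeg.trans (by exact_mod_cast hde)

/-- A lattice vector on `S₁ ∪ S₂` splits as soon as `S₁` and `S₂` share a nonzero element: a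
multiple of that element balances the weight of the part supported on `S₁`. -/
theorem latFin_union_le_sup {p : ℕ} [Fact p.Prime] {S₁ S₂ : Finset (ZMod p)} {ψ : ZMod p}
    (hψ₁ : ψ ∈ S₁) (hψ₂ : ψ ∈ S₂) (hψ : ψ ≠ 0) :
    latFin (S₁ ∪ S₂) ≤ latFin S₁ ⊔ latFin S₂ := by
  intro a ha
  set w : ZMod p := ∑ χ ∈ S₁, a χ • χ with hw
  obtain ⟨k, hk⟩ := ZMod.intCast_surjective (w * ψ⁻¹)
  have hkψ : k • ψ = w := by
    rw [zsmul_eq_mul, hk, mul_assoc, inv_mul_cancel₀ hψ, mul_one]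
  set b : ZMod p → ℤ := fun χ => (if χ ∈ S₁ then a χ else 0) - if χ = ψ then k else 0 with hb
  have hb₁ : b ∈ latFin S₁ := by
    refine ⟨fun χ hχ => ?_, ?_⟩
    · have : χ ≠ ψ := fun h => hχ (h ▸ hψ₁)
      simp [hb, hχ, this]
    · have hsplit : ∀ χ ∈ S₁, b χ • χ = a χ • χ - if χ = ψ then k • ψ else 0 := by
        intro χ hχ
        by_cases h : χ = ψ
        · subst h
          simp [hb, hχ, sub_mul]
        · simp [hb, hχ, h]
      rw [Finset.sum_congr rfl hsplit, Finset.sum_sub_distrib, ← hw, Finset.sum_ite_eq',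
        if_pos hψ₁, hkψ, sub_self]
  have hab : a - b ∈ latFin S₂ := by
    refine (mem_latFin_iff_of_subset Finset.subset_union_right fun χ hχ => ?_).1
      (sub_mem ha (latFin_mono Finset.subset_union_left hb₁))
    have hne : χ ≠ ψ := fun h => hχ (h ▸ hψ₂)
    by_cases h : χ ∈ S₁
    · simp [hb, h, hne]
    · simp [hb, h, hne, ha.1 χ (by simp [h, hχ])]
  rw [← add_sub_cancel b a]
  exact AddSubgroup.add_mem_sup hb₁ hab

/-- Let `p` be prime and `S₁, S₂ ⊆ ℤ/pℤ` finite sets avoiding `0` with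
`S₁ ∩ S₂ ≠ ∅`. If `L(Sᵢ)` is generated in degree `≤ dᵢ` for `i = 1, 2`, then `L(S₁ ∪ S₂)` is
generated in degree `≤ max d₁ d₂`. -/
theorem stmt_7 (p : ℕ) (hp : p.Prime) (S₁ S₂ : Finset (ZMod p))
    (h0 : (0 : ZMod p) ∉ S₁ ∪ S₂) (hne : (S₁ ∩ S₂).Nonempty)
    (d₁ d₂ : ℕ) (h1 : genLE S₁ d₁) (h2 : genLE S₂ d₂) :
    genLE (S₁ ∪ S₂) (max d₁ d₂) := by
  have : Fact p.Prime := ⟨hp⟩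
  obtain ⟨ψ, hψ⟩ := hne
  rw [Finset.mem_inter] at hψ
  have hψ0 : ψ ≠ 0 := fun h => h0 (h ▸ Finset.mem_union_left _ hψ.1)
  refine le_antisymm ((AddSubgroup.closure_le _).2 fun a ha => ha.1) ?_
  exact (latFin_union_le_sup hψ.1 hψ.2 hψ0).trans <| sup_le
    (h1.latFin_le_closure Finset.subset_union_left (le_max_left _ _))
    (h2.latFin_le_closure Finset.subset_union_right (le_max_right _ _))
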